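/- Let Ω be a nondegenerate triangle in ℝ², let N ≥ 1 be an integer, and let P = (f_Ω(0), f_Ω(1), …, f_Ω(N−1)) be the first N triangular van der Corput points of Ω. Then D_N^P(P;Ω) ≤ 12/√N. -/

import Mathlib

open MeasureTheory Filter Real

noncomputable section

/-- Points of the plane. -/
abbrev Pt := ℝ × ℝ

/-- The (closed) triangle with vertices `A`, `B`, `C`: their convex hull. -/
def triangle (A B C : Pt) : Set Pt := convexHull ℝ {A, B, C}

/-- The triangle `Δ(A,B,C)` is nondegenerate iff `A`, `B`, `C` are not collinear. -/
def Nondeg (A B C : Pt) : Prop := ¬ Collinear ℝ ({A, B, C} : Set Pt)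

/-- Two-dimensional Lebesgue volume, as a real number. -/
def vol (S : Set Pt) : ℝ := (volume S).toReal

/-- Signed discrepancy `δ_N(S; P, Ω)` of the list of points `P` at the set `S`,
relative to the domain `Ω`. -/
def sdisc {N : ℕ} (S : Set Pt) (P : Fin N → Pt) (Ω : Set Pt) : ℝ :=
  vol (S ∩ Ω) / vol Ω - (Nat.card {i : Fin N // P i ∈ S} : ℝ) / N

/-- Discrepancy `D_N(𝒮; P, Ω)`: supremum of the absolute signed discrepancy
over a class `𝒮` of sets. -/
def Disc {N : ℕ} (𝒮 : Set (Set Pt)) (P : Fin N → Pt) (Ω : Set Pt) : ℝ :=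
  ⨆ S ∈ 𝒮, |sdisc S P Ω|

/-- The half-open parallelogram `𝒯_{a,b,C}` anchored at `C` with sides
`a(A-C)` and `b(B-C)`. -/
def parlg (A B C : Pt) (a b : ℝ) : Set Pt :=
  {x | ∃ s t : ℝ, 0 ≤ s ∧ s < a ∧ 0 ≤ t ∧ t < b ∧ x = C + s • (A - C) + t • (B - C)}

/-- The family `𝒮_C` of parallelograms anchored at `C`, intersected with the triangle. -/
def anchoredFam (A B C : Pt) : Set (Set Pt) :=
  {S | ∃ a b : ℝ, 0 < a ∧ a ≤ 1 ∧ 0 < b ∧ b ≤ 1 ∧ S = parlg A B C a b ∩ triangle A B C}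

/-- The class `𝒮_A ∪ 𝒮_B ∪ 𝒮_C` of anchored parallelograms of the triangle `Δ(A,B,C)`. -/
def parFam (A B C : Pt) : Set (Set Pt) :=
  anchoredFam B C A ∪ anchoredFam A C B ∪ anchoredFam A B C

/-- The parallelogram discrepancy `D_N^P(P; Δ(A,B,C))`. -/
def parDisc {N : ℕ} (P : Fin N → Pt) (A B C : Pt) : ℝ :=
  Disc (parFam A B C) P (triangle A B C)

/-- Midpoint of two points. -/
def mid (P Q : Pt) : Pt := (2⁻¹ : ℝ) • (P + Q)

/-- A triangle recorded as the (ordered) triple of its vertices. -/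
abbrev Tri2 := Pt × Pt × Pt

/-- The centroid of a triangle: the average of its three vertices. -/
def ctr (T : Tri2) : Pt := (3⁻¹ : ℝ) • (T.1 + T.2.1 + T.2.2)

/-- The point set of a triangle given by its vertices. -/
def triSet (T : Tri2) : Set Pt := triangle T.1 T.2.1 T.2.2

/-- The four-way subdivision of a triangle: subtriangle number `d ∈ {0,1,2,3}`. -/
def subdiv (T : Tri2) (d : ℕ) : Tri2 :=
  let A := T.1; let B := T.2.1; let C := T.2.2
  if d = 0 then (mid B C, mid A C, mid A B)
  else if d = 1 then (A, mid A B, mid A C)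
  else if d = 2 then (mid A B, B, mid B C)
  else (mid A C, mid B C, C)

/-- The triangular van der Corput point `f_T(i)`: digits of `i` in base `4` select a
nested subtriangle, and `f_T(i)` is its centroid. -/
def vdc (T : Tri2) (i : ℕ) : Pt :=
  if h : i = 0 then ctr T else vdc (subdiv T (i % 4)) (i / 4)
termination_by i
decreasing_by exact Nat.div_lt_self (Nat.pos_of_ne_zero h) (by norm_num)

/-- The `i`-th subtriangle (for `i < 4^k`) of the standard level-`k` subdivision of `T`,
indexed by the base-4 digits of `i`. -/
def subdivAt (T : Tri2) : ℕ → ℕ → Tri2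
  | 0, _ => T
  | (k+1), i => subdiv (subdivAt T k (i / 4)) (i % 4)

/-- The standard level-`k` subdivision of a triangle: the set of the `4^k` congruent
subtriangles obtained by `k` recursive four-way subdivisions. -/
def level (T : Tri2) : ℕ → Set Tri2
  | 0 => {T}
  | (k+1) => {S | ∃ S' ∈ level T k, ∃ d < 4, S = subdiv S' d}

/-- Riemann integrability (in the triangular-subdivision sense) of `f` on the closed
triangle `T`, with integral mean `μ`: every sequence of tagged Riemann sums over the
level-`k` subdivisions converges to `μ`. -/
def RiemannMean (T : Tri2) (f : Pt → ℝ) (μ : ℝ) : Prop :=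
  ∀ x : ℕ → ℕ → Pt, (∀ k i, i < 4^k → x k i ∈ triSet (subdivAt T k i)) →
    Tendsto (fun k => (4^k : ℝ)⁻¹ * ∑ i ∈ Finset.range (4^k), f (x k i)) atTop (nhds μ)

/-- A real number is a quadratic irrational if it has the form `(a + b√c)/d` with
integers `a,b,c,d`, `b ≠ 0`, `d ≠ 0`, `c > 0` and `c` not a perfect square. -/
def QuadIrr (θ : ℝ) : Prop :=
  ∃ a b c d : ℤ, b ≠ 0 ∧ d ≠ 0 ∧ 0 < c ∧ (∀ m : ℤ, c ≠ m ^ 2) ∧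
    θ = ((a : ℝ) + (b : ℝ) * Real.sqrt (c : ℝ)) / (d : ℝ)

/-- Distance from a real number to the nearest integer. -/
def distToInt (x : ℝ) : ℝ := |x - round x|

/-- A real number `θ` is badly approximable if `n‖nθ‖ > c` for all positive `n`,
for some constant `c > 0`. -/
def BadlyApprox (θ : ℝ) : Prop :=
  ∃ c : ℝ, 0 < c ∧ ∀ n : ℕ, 0 < n → c < (n : ℝ) * distToInt ((n : ℝ) * θ)

end

/-- The iterated subtriangle of `T` selected by the `k` lowest base-4 digits of `r`,
least significant digit first. -/
noncomputable def lowSubdiv (T : Tri2) : ℕ → ℕ → Tri2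
  | 0, _ => T
  | (k+1), r => lowSubdiv (subdiv T (r % 4)) k (r / 4)

/-- Offset of the coordinate numbered `c` at the vertex numbered `d` of a grid triangle, relative to
the smallest value of that coordinate on the triangle; `neg` says whether the triangle is inverted. -/
def cornerBit (c d : ℕ) (neg : Bool) : ℕ := if (decide (d = c) ^^ neg) = true then 1 else 0

/-- The vertices of `T` have `φ`-values `p / n` and `(p + 1) / n`, distributed as for the coordinate
numbered `c` of an upright (`neg = false`) or inverted (`neg = true`) grid triangle. -/
def GridVals (φ : Pt →ᵃ[ℝ] ℝ) (c n : ℕ) (T : Tri2) (p : ℕ) (neg : Bool) : Prop :=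
  n * φ T.1 = p + cornerBit c 1 neg ∧ n * φ T.2.1 = p + cornerBit c 2 neg ∧
    n * φ T.2.2 = p + cornerBit c 3 neg

/-- Effect of passing to subtriangle number `d` on the grid position of a triangle with respect to
the coordinates numbered `c` and `c'`. -/
def gridStep (c c' : ℕ) (s : ℕ × ℕ × Bool) (d : ℕ) : ℕ × ℕ × Bool :=
  (2 * s.1 + cornerBit c d s.2.2, 2 * s.2.1 + cornerBit c' d s.2.2, s.2.2 ^^ decide (d = 0))

/-- Grid position of the iterated subtriangle `lowSubdiv T k r` if that of `T` is `s`. -/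
def gridPos (c c' : ℕ) (s : ℕ × ℕ × Bool) : ℕ → ℕ → ℕ × ℕ × Bool
  | 0, _ => s
  | (k+1), r => gridPos c c' (gridStep c c' s (r % 4)) k (r / 4)

lemma vdc_rec (T : Tri2) (i : ℕ) : vdc T i = vdc (subdiv T (i % 4)) (i / 4) := by
  rcases eq_or_ne i 0 with rfl | hi
  · rw [vdc, vdc]
    simp only [ctr, subdiv, mid, dite_true, Nat.zero_mod, Nat.zero_div, if_true]
    module
  · conv_lhs => rw [vdc]
    simp [hi]

lemma vdc_block (k m r : ℕ) (hr : r < 4 ^ k) (T : Tri2) :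
    vdc T (m * 4 ^ k + r) = vdc (lowSubdiv T k r) m := by
  induction k generalizing T r with
  | zero => simp_all [lowSubdiv]
  | succ k ih =>
    rw [vdc_rec, lowSubdiv, ← ih (r / 4) (by rw [pow_succ] at hr; omega)]
    have h1 : m * 4 ^ (k + 1) = 4 * (m * 4 ^ k) := by ring
    congr 2 <;> omega

lemma mem_triangle_iff {A B C x : Pt} : x ∈ triangle A B C ↔
    ∃ a b c : ℝ, 0 ≤ a ∧ 0 ≤ b ∧ 0 ≤ c ∧ a + b + c = 1 ∧ a • A + b • B + c • C = x := by
  constructor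
  · intro h
    rw [triangle, convexHull_insert (Set.insert_nonempty _ _), convexHull_pair, mem_convexJoin] at h
    obtain ⟨P, rfl, Q, ⟨u, v, hu, hv, huv, rfl⟩, ⟨s, t, hs, ht, hst, rfl⟩⟩ := h
    refine ⟨s, t * u, t * v, hs, by positivity, by positivity, ?_, by module⟩
    rw [add_assoc, ← mul_add, huv, mul_one, hst]
  · rintro ⟨a, b, c, ha, hb, hc, hs, rfl⟩
    have := (convex_convexHull ℝ {A, B, C}).sum_mem (t := Finset.univ) (w := ![a, b, c])
      (z := ![A, B, C]) ?_ ?_ ?_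
    · simpa [Fin.sum_univ_three, triangle] using this
    · intro i _; fin_cases i <;> simpa
    · simpa [Fin.sum_univ_three] using hs
    · intro i _
      apply subset_convexHull
      fin_cases i <;> simp

lemma triSet_subset_biUnion (T : Tri2) : triSet T ⊆ ⋃ d ∈ Finset.range 4, triSet (subdiv T d) := by
  intro x hx
  obtain ⟨a, b, c, ha, hb, hc, hs, rfl⟩ := mem_triangle_iff.1 hx
  simp only [Set.mem_iUnion, Finset.mem_range]
  have hc' : c = 1 - a - b := by linarith
  by_cases h1 : 1 / 2 ≤ a
  · refine ⟨1, by norm_num, mem_triangle_iff.2 ⟨2 * a - 1, 2 * b, 2 * c, by linarith, by linarith,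
      by linarith, by linarith, ?_⟩⟩
    simp only [subdiv, mid, hc', one_ne_zero, if_false, if_true]
    module
  by_cases h2 : 1 / 2 ≤ b
  · refine ⟨2, by norm_num, mem_triangle_iff.2 ⟨2 * a, 2 * b - 1, 2 * c, by linarith, by linarith,
      by linarith, by linarith, ?_⟩⟩
    simp only [subdiv, mid, hc', OfNat.ofNat_ne_zero, OfNat.ofNat_ne_one, if_false, if_true]
    module
  by_cases h3 : 1 / 2 ≤ c
  · refine ⟨3, by norm_num, mem_triangle_iff.2 ⟨2 * a, 2 * b, 2 * c - 1, by linarith, by linarith,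
      by linarith, by linarith, ?_⟩⟩
    simp [subdiv, mid, hc']
    module
  · refine ⟨0, by norm_num, mem_triangle_iff.2 ⟨1 - 2 * a, 1 - 2 * b, 1 - 2 * c, by linarith,
      by linarith, by linarith, by linarith, ?_⟩⟩
    simp only [subdiv, mid, hc', if_true]
    module

lemma triSet_subset_iUnion_lowSubdiv (T : Tri2) (k : ℕ) :
    triSet T ⊆ ⋃ r ∈ Finset.range (4 ^ k), triSet (lowSubdiv T k r) := by
  induction k generalizing T with
  | zero => simp [lowSubdiv]
  | succ k ih =>
    intro x hx
    obtain ⟨d, hd, hx⟩ := Set.mem_iUnion₂.1 (triSet_subset_biUnion T hx)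
    obtain ⟨r, hr, hx⟩ := Set.mem_iUnion₂.1 (ih _ hx)
    rw [Finset.mem_range] at hd hr
    refine Set.mem_iUnion₂.2 ⟨4 * r + d, ?_, ?_⟩
    · rw [Finset.mem_range, pow_succ]; omega
    · rwa [lowSubdiv, show (4 * r + d) % 4 = d by omega, show (4 * r + d) / 4 = r by omega]

lemma triSet_eq_image_homothety (T : Tri2) (d : ℕ) : ∃ (x : Pt) (ρ : ℝ), |ρ| = 1 / 2 ∧
    triSet (subdiv T d) = AffineMap.homothety x ρ '' triSet T := by
  obtain ⟨A, B, C⟩ := T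
  suffices h : ∃ (x : Pt) (ρ : ℝ), |ρ| = 1 / 2 ∧ subdiv (A, B, C) d =
      (AffineMap.homothety x ρ A, AffineMap.homothety x ρ B, AffineMap.homothety x ρ C) by
    obtain ⟨x, ρ, hρ, h⟩ := h
    refine ⟨x, ρ, hρ, ?_⟩
    rw [h, triSet, triSet, triangle, triangle, AffineMap.image_convexHull]
    simp [Set.image_insert_eq]
  simp only [subdiv, mid, AffineMap.homothety_apply, vsub_eq_sub, vadd_eq_add]
  split_ifs
  · refine ⟨(3⁻¹ : ℝ) • (A + B + C), -1 / 2, by norm_num [abs_of_neg], ?_⟩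
    ext1 <;> [skip; ext1] <;> dsimp only <;> module
  · refine ⟨A, 1 / 2, by norm_num, ?_⟩
    ext1 <;> [skip; ext1] <;> dsimp only <;> module
  · refine ⟨B, 1 / 2, by norm_num, ?_⟩
    ext1 <;> [skip; ext1] <;> dsimp only <;> module
  · refine ⟨C, 1 / 2, by norm_num, ?_⟩
    ext1 <;> [skip; ext1] <;> dsimp only <;> module

lemma vol_subdiv (T : Tri2) (d : ℕ) : vol (triSet (subdiv T d)) = vol (triSet T) / 4 := by
  obtain ⟨x, ρ, hρ, h⟩ := triSet_eq_image_homothety T d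
  rw [vol, h, Measure.addHaar_image_homothety, ENNReal.toReal_mul,
    ENNReal.toReal_ofReal (abs_nonneg _), abs_pow, hρ, vol]
  norm_num
  ring

lemma vol_lowSubdiv (T : Tri2) (k r : ℕ) :
    vol (triSet (lowSubdiv T k r)) = vol (triSet T) / 4 ^ k := by
  induction k generalizing T r with
  | zero => simp [lowSubdiv]
  | succ k ih => rw [lowSubdiv, ih, vol_subdiv]; ring

lemma triSet_subdiv_subset (T : Tri2) (d : ℕ) : triSet (subdiv T d) ⊆ triSet T := by
  have hm : ∀ {P Q : Pt}, P ∈ triSet T → Q ∈ triSet T → mid P Q ∈ triSet T := by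
    intro P Q hP hQ
    have := convex_convexHull ℝ {T.1, T.2.1, T.2.2} hP hQ (a := 2⁻¹) (b := 2⁻¹)
      (by norm_num) (by norm_num) (by norm_num)
    rwa [mid, smul_add]
  have hA : T.1 ∈ triSet T := subset_convexHull _ _ (by simp)
  have hB : T.2.1 ∈ triSet T := subset_convexHull _ _ (by simp)
  have hC : T.2.2 ∈ triSet T := subset_convexHull _ _ (by simp)
  refine convexHull_min ?_ (convex_convexHull ℝ _)
  simp only [subdiv]
  split_ifs <;> simp only [Set.insert_subset_iff, Set.singleton_subset_iff] <;>
    exact ⟨by first | assumption | exact hm ‹_› ‹_›, by first | assumption | exact hm ‹_› ‹_›,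
      by first | assumption | exact hm ‹_› ‹_›⟩

lemma triSet_lowSubdiv_subset (T : Tri2) (k r : ℕ) : triSet (lowSubdiv T k r) ⊆ triSet T := by
  induction k generalizing T r with
  | zero => simp [lowSubdiv]
  | succ k ih => exact (ih _ _).trans (triSet_subdiv_subset _ _)

lemma vdc_mem_triSet (T : Tri2) (i : ℕ) : vdc T i ∈ triSet T := by
  induction i using Nat.strong_induction_on generalizing T with
  | _ i ih =>
    rcases eq_or_ne i 0 with rfl | hi
    · rw [vdc, dif_pos rfl]
      refine mem_triangle_iff.2 ⟨3⁻¹, 3⁻¹, 3⁻¹, by norm_num, by norm_num, by norm_num,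
        by norm_num, ?_⟩
      simp [ctr]
    · rw [vdc_rec]
      exact triSet_subdiv_subset _ _ (ih _ (by omega) _)

lemma affineMap_mid (φ : Pt →ᵃ[ℝ] ℝ) (P Q : Pt) : φ (mid P Q) = (φ P + φ Q) / 2 := by
  rw [show mid P Q = midpoint ℝ P Q by rw [midpoint_eq_smul_add, mid, invOf_eq_inv],
    φ.map_midpoint, midpoint_eq_smul_add, invOf_eq_inv, smul_eq_mul]
  ring

lemma GridVals.subdiv {φ : Pt →ᵃ[ℝ] ℝ} {c n p : ℕ} {T : Tri2} {neg : Bool}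
    (h : GridVals φ c n T p neg) (hc : c = 1 ∨ c = 2 ∨ c = 3) {d : ℕ} (hd : d < 4) :
    GridVals φ c (2 * n) (subdiv T d) (2 * p + cornerBit c d neg) (neg ^^ decide (d = 0)) := by
  obtain ⟨h1, h2, h3⟩ := h
  rcases hc with rfl | rfl | rfl <;> interval_cases d <;> cases neg <;>
    simp [GridVals, _root_.subdiv, cornerBit, affineMap_mid] at * <;>
    refine ⟨?_, ?_, ?_⟩ <;> linarith

lemma GridVals.lowSubdiv {φ ψ : Pt →ᵃ[ℝ] ℝ} {c c' n : ℕ} {T : Tri2} {s : ℕ × ℕ × Bool}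
    (h : GridVals φ c n T s.1 s.2.2) (h' : GridVals ψ c' n T s.2.1 s.2.2)
    (hc : c = 1 ∨ c = 2 ∨ c = 3) (hc' : c' = 1 ∨ c' = 2 ∨ c' = 3) (k r : ℕ) :
    GridVals φ c (2 ^ k * n) (lowSubdiv T k r) (gridPos c c' s k r).1 (gridPos c c' s k r).2.2 ∧
    GridVals ψ c' (2 ^ k * n) (lowSubdiv T k r) (gridPos c c' s k r).2.1
      (gridPos c c' s k r).2.2 := by
  induction k generalizing n T s r with
  | zero => simpa [_root_.lowSubdiv, gridPos] using ⟨h, h'⟩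
  | succ k ih =>
    have hd : r % 4 < 4 := Nat.mod_lt _ (by norm_num)
    have := ih (s := gridStep c c' s (r % 4)) (h.subdiv hc hd) (h'.subdiv hc' hd) (r / 4)
    rwa [← mul_assoc, ← pow_succ] at this

lemma GridVals.bounds {φ : Pt →ᵃ[ℝ] ℝ} {c n p : ℕ} {T : Tri2} {neg : Bool}
    (h : GridVals φ c n T p neg) {x : Pt} (hx : x ∈ triSet T) :
    (p : ℝ) ≤ n * φ x ∧ n * φ x ≤ p + 1 := by
  have hb : ∀ d, (0 : ℝ) ≤ cornerBit c d neg ∧ (cornerBit c d neg : ℝ) ≤ 1 := by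
    intro d; unfold cornerBit; split_ifs <;> norm_num
  have key : triSet T ⊆ φ ⁻¹' {y | (p : ℝ) ≤ n * y ∧ n * y ≤ p + 1} := by
    refine convexHull_min ?_ (Convex.affine_preimage φ ?_)
    · obtain ⟨h1, h2, h3⟩ := h
      simp only [Set.insert_subset_iff, Set.singleton_subset_iff, Set.mem_preimage,
        Set.mem_ofPred_eq, h1, h2, h3]
      refine ⟨?_, ?_, ?_⟩ <;> constructor <;>
        linarith [(hb 1).1, (hb 1).2, (hb 2).1, (hb 2).2, (hb 3).1, (hb 3).2]
    · have := (convex_Icc (p : ℝ) (p + 1)).linear_preimage (LinearMap.mulLeft ℝ (n : ℝ))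
      exact this
  exact key hx

lemma gridStep_inj {c c' : ℕ} (hc : c = 1 ∨ c = 2 ∨ c = 3) (hc' : c' = 1 ∨ c' = 2 ∨ c' = 3)
    (hne : c ≠ c') {s s' : ℕ × ℕ × Bool} {d d' : ℕ} (hd : d < 4) (hd' : d' < 4)
    (h : gridStep c c' s d = gridStep c c' s' d') : s = s' ∧ d = d' := by
  obtain ⟨p, q, e⟩ := s
  obtain ⟨p', q', e'⟩ := s'
  rcases hc with rfl | rfl | rfl <;> rcases hc' with rfl | rfl | rfl <;> try contradiction
  all_goals
    interval_cases d <;> interval_cases d' <;> cases e <;> cases e' <;>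
      simp [gridStep, cornerBit] at h ⊢ <;> omega

lemma gridPos_inj {c c' : ℕ} (hc : c = 1 ∨ c = 2 ∨ c = 3) (hc' : c' = 1 ∨ c' = 2 ∨ c' = 3)
    (hne : c ≠ c') {k : ℕ} {s s' : ℕ × ℕ × Bool} {r r' : ℕ} (hr : r < 4 ^ k) (hr' : r' < 4 ^ k)
    (h : gridPos c c' s k r = gridPos c c' s' k r') : s = s' ∧ r = r' := by
  induction k generalizing s s' r r' with
  | zero => simp_all [gridPos]
  | succ k ih =>
    rw [pow_succ] at hr hr'
    obtain ⟨h1, h2⟩ := ih (by omega) (by omega) h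
    obtain ⟨h3, h4⟩ := gridStep_inj hc hc' hne (Nat.mod_lt _ (by norm_num))
      (Nat.mod_lt _ (by norm_num)) h1
    exact ⟨h3, by omega⟩

lemma gridPos_add_lt {c c' : ℕ} (hne : c ≠ c') (hc : c ≠ 0) (hc' : c' ≠ 0) {n : ℕ}
    {s : ℕ × ℕ × Bool} (k r : ℕ) (h : s.1 + s.2.1 + 1 + s.2.2.toNat ≤ n) :
    (gridPos c c' s k r).1 + (gridPos c c' s k r).2.1 < 2 ^ k * n := by
  induction k generalizing n s r with
  | zero => simp [gridPos]; omega
  | succ k ih =>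
    rw [pow_succ, mul_assoc]
    refine ih _ ?_
    obtain ⟨p, q, e⟩ := s
    generalize r % 4 = d
    cases e <;> by_cases h0 : d = 0 <;> by_cases h1 : d = c <;> by_cases h2 : d = c' <;>
      simp_all [gridStep, cornerBit] <;> omega

/-- The part of the triangle `T` cut off by `φ < a` and `ψ < b`. -/
def cutSet (T : Tri2) (φ ψ : Pt →ᵃ[ℝ] ℝ) (a b : ℝ) : Set Pt := {x ∈ triSet T | φ x < a ∧ ψ x < b}

open Classical in
lemma card_crossing_le {T : Tri2} {φ ψ : Pt →ᵃ[ℝ] ℝ} {c c' : ℕ} (h : GridVals φ c 1 T 0 false)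
    (h' : GridVals ψ c' 1 T 0 false) (hc : c = 1 ∨ c = 2 ∨ c = 3) (hc' : c' = 1 ∨ c' = 2 ∨ c' = 3)
    (hne : c ≠ c') (a b : ℝ) (k : ℕ) :
    ((Finset.range (4 ^ k)).filter fun r =>
      (triSet (lowSubdiv T k r) ∩ cutSet T φ ψ a b).Nonempty ∧
        ¬ triSet (lowSubdiv T k r) ⊆ cutSet T φ ψ a b).card ≤ 2 * 2 ^ k := by
  set g := gridPos c c' (0, 0, false) k
  let F : ℕ → ℕ × Bool := fun r =>
    (if (2 ^ k : ℕ) * a ≤ (g r).1 + 1 then (g r).2.1 else 2 ^ k - 1 - (g r).1, (g r).2.2)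
  have hsum : ∀ r, (g r).1 + (g r).2.1 < 2 ^ k := fun r => by
    simpa using gridPos_add_lt (s := (0, 0, false)) hne (by omega) (by omega) k r (n := 1) (by simp)
  have hcross : ∀ r, (triSet (lowSubdiv T k r) ∩ cutSet T φ ψ a b).Nonempty →
      ¬ triSet (lowSubdiv T k r) ⊆ cutSet T φ ψ a b → ((g r).1 : ℝ) < (2 ^ k : ℕ) * a ∧
      ((g r).2.1 : ℝ) < (2 ^ k : ℕ) * b ∧
      ((2 ^ k : ℕ) * a ≤ (g r).1 + 1 ∨ (2 ^ k : ℕ) * b ≤ (g r).2.1 + 1) := by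
    rintro r ⟨x, hx, -, hxa, hxb⟩ hy
    obtain ⟨y, hy, hyS⟩ := Set.not_subset.1 hy
    have hG := GridVals.lowSubdiv (s := (0, 0, false)) h h' hc hc' k r
    rw [mul_one] at hG
    have hn : (0 : ℝ) < (2 ^ k : ℕ) := by positivity
    refine ⟨(hG.1.bounds hx).1.trans_lt (by gcongr), (hG.2.bounds hx).1.trans_lt (by gcongr), ?_⟩
    by_contra! hcon
    refine hyS ⟨triSet_lowSubdiv_subset _ _ _ hy, ?_, ?_⟩
    · exact lt_of_mul_lt_mul_left ((hG.1.bounds hy).2.trans_lt hcon.1) hn.le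
    · exact lt_of_mul_lt_mul_left ((hG.2.bounds hy).2.trans_lt hcon.2) hn.le
  have hcard : (Finset.range (2 ^ k) ×ˢ (Finset.univ : Finset Bool)).card = 2 * 2 ^ k := by
    simp [mul_comm]
  rw [← hcard]
  refine Finset.card_le_card_of_injOn F ?_ ?_
  · intro r _
    have := hsum r
    simp only [F, Finset.coe_product, Finset.coe_univ, Set.mem_prod, Set.mem_univ, and_true,
      Finset.mem_coe, Finset.mem_range]
    split_ifs <;> omega
  · intro r hr r' hr' hF
    simp only [Finset.coe_filter, Finset.mem_range, Set.mem_ofPred_eq] at hr hr'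
    obtain ⟨h1, h2, h3⟩ := hcross r hr.2.1 hr.2.2
    obtain ⟨h1', h2', h3'⟩ := hcross r' hr'.2.1 hr'.2.2
    have hs := hsum r
    have hs' := hsum r'
    refine (gridPos_inj hc hc' hne hr.1 hr'.1 (s := (0, 0, false)) (s' := (0, 0, false)) ?_).2
    simp only [F, Prod.mk.injEq] at hF
    have cast_le : ∀ {u v : ℕ} {w : ℝ}, (u : ℝ) < w → w ≤ v + 1 → u ≤ v := by
      intro u v w hu hv
      exact Nat.lt_succ_iff.1 (by exact_mod_cast hu.trans_le hv)
    have cast_lt : ∀ {u v : ℕ} {w : ℝ}, ¬ w ≤ u + 1 → w ≤ v + 1 → u < v := by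
      intro u v w hu hv
      have : (u : ℝ) + 1 < v + 1 := (not_le.1 hu).trans_le hv
      exact_mod_cast (add_lt_add_iff_right _).1 this
    have key : (g r).1 = (g r').1 ∧ (g r).2.1 = (g r').2.1 := by
      obtain ⟨hF, -⟩ := hF
      split_ifs at hF with ha ha' ha'
      · exact ⟨le_antisymm (cast_le h1 ha') (cast_le h1' ha), hF⟩
      · have := cast_lt ha' ha
        omega
      · have := cast_lt ha ha'
        omega
      · have hb := h3.resolve_left ha
        have hb' := h3'.resolve_left ha'
        exact ⟨by omega, le_antisymm (cast_le h2 hb') (cast_le h2' hb)⟩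
    exact Prod.ext key.1 (Prod.ext key.2 hF.2)

open Classical in
lemma block_discrepancy_le {T : Tri2} {φ ψ : Pt →ᵃ[ℝ] ℝ} {c c' : ℕ} (h : GridVals φ c 1 T 0 false)
    (h' : GridVals ψ c' 1 T 0 false) (hc : c = 1 ∨ c = 2 ∨ c = 3) (hc' : c' = 1 ∨ c' = 2 ∨ c' = 3)
    (hne : c ≠ c') (a b : ℝ) (hT : 0 < vol (triSet T)) (k m : ℕ) :
    |∑ r ∈ Finset.range (4 ^ k), ((if vdc T (m * 4 ^ k + r) ∈ cutSet T φ ψ a b then (1 : ℝ) else 0)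
      - vol (cutSet T φ ψ a b) / vol (triSet T))| ≤ 2 * 2 ^ k := by
  set S := cutSet T φ ψ a b with hS
  have hST : S ⊆ triSet T := fun x hx => hx.1
  have hfin : ∀ U : Tri2, volume (triSet U) ≠ ⊤ := fun U =>
    (Set.Finite.isCompact_convexHull ℝ (Set.toFinite _)).measure_ne_top
  have hcross := card_crossing_le h h' hc hc' hne a b k
  rw [← hS] at hcross
  set R := Finset.range (4 ^ k) with hR
  set inner := R.filter fun r => triSet (lowSubdiv T k r) ⊆ S with hinner
  set hits := R.filter fun r => vdc T (m * 4 ^ k + r) ∈ S with hhits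
  set meets := R.filter fun r => (triSet (lowSubdiv T k r) ∩ S).Nonempty with hmeets
  have hmem : ∀ r ∈ R, vdc T (m * 4 ^ k + r) ∈ triSet (lowSubdiv T k r) := fun r hr => by
    rw [vdc_block k m r (Finset.mem_range.1 hr)]
    exact vdc_mem_triSet _ _
  have h1 : inner.card ≤ hits.card := Finset.card_le_card fun r hr => by
    simp only [hinner, hhits, Finset.mem_filter] at hr ⊢
    exact ⟨hr.1, hr.2 (hmem r hr.1)⟩
  have h2 : hits.card ≤ meets.card := Finset.card_le_card fun r hr => by
    simp only [hmeets, hhits, Finset.mem_filter] at hr ⊢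
    exact ⟨hr.1, _, hmem r hr.1, hr.2⟩
  have h3 : meets.card ≤ inner.card + 2 * 2 ^ k := by
    refine le_trans (Finset.card_le_card ?_) ((Finset.card_union_le _ _).trans
      (Nat.add_le_add_left hcross _))
    intro r hr
    simp only [hmeets, hinner, Finset.mem_union, Finset.mem_filter] at hr ⊢
    tauto
  have hunion : ∀ t : Finset ℕ, vol (⋃ r ∈ t, triSet (lowSubdiv T k r)) ≤
      t.card * (vol (triSet T) / 4 ^ k) := fun t => by
    refine (measureReal_biUnion_finset_le t _).trans ?_
    simp only [← nsmul_eq_mul]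
    exact Finset.sum_le_card_nsmul _ _ _ fun r _ => (vol_lowSubdiv T k r).le
  have hufin : ∀ t : Finset ℕ, volume (⋃ r ∈ t, triSet (lowSubdiv T k r)) ≠ ⊤ := fun t =>
    (measure_biUnion_lt_top t.finite_toSet fun r _ => (hfin _).lt_top).ne
  have h4 : vol S ≤ meets.card * (vol (triSet T) / 4 ^ k) := by
    refine le_trans (measureReal_mono ?_ (hufin _)) (hunion meets)
    intro x hx
    obtain ⟨r, hr, hxr⟩ := Set.mem_iUnion₂.1 (triSet_subset_iUnion_lowSubdiv T k (hST hx))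
    exact Set.mem_iUnion₂.2 ⟨r, Finset.mem_filter.2 ⟨hr, x, hxr, hx⟩, hxr⟩
  have h5 : vol (triSet T) ≤ vol S + (R \ inner).card * (vol (triSet T) / 4 ^ k) := by
    have hsub : triSet T ⊆ S ∪ ⋃ r ∈ R \ inner, triSet (lowSubdiv T k r) := by
      intro x hx
      obtain ⟨r, hr, hxr⟩ := Set.mem_iUnion₂.1 (triSet_subset_iUnion_lowSubdiv T k hx)
      by_cases hi : r ∈ inner
      · exact Or.inl ((Finset.mem_filter.1 hi).2 hxr)
      · exact Or.inr (Set.mem_iUnion₂.2 ⟨r, Finset.mem_sdiff.2 ⟨hr, hi⟩, hxr⟩)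
    refine (measureReal_mono hsub (measure_union_ne_top ?_ (hufin _))).trans
      ((measureReal_union_le _ _).trans (add_le_add le_rfl (hunion _)))
    exact ne_top_of_le_ne_top (hfin T) (measure_mono hST)
  have h6 : ((R \ inner).card : ℝ) = 4 ^ k - inner.card := by
    rw [Finset.cast_card_sdiff (Finset.filter_subset _ _), hR, Finset.card_range]
    push_cast
    rfl
  have hpow : (0 : ℝ) < 4 ^ k := by positivity
  have h7 : 4 ^ k * (vol S / vol (triSet T)) ≤ meets.card := by
    rw [← mul_div_assoc, div_le_iff₀ hT]
    calc 4 ^ k * vol S ≤ 4 ^ k * (meets.card * (vol (triSet T) / 4 ^ k)) := by gcongr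
      _ = meets.card * vol (triSet T) := by field_simp
  have h8 : inner.card ≤ 4 ^ k * (vol S / vol (triSet T)) := by
    rw [← mul_div_assoc, le_div_iff₀ hT]
    have := mul_le_mul_of_nonneg_left h5 hpow.le
    rw [h6] at this
    have e : (4 : ℝ) ^ k * (vol S + (4 ^ k - inner.card) * (vol (triSet T) / 4 ^ k)) =
        4 ^ k * vol S + (4 ^ k - inner.card) * vol (triSet T) := by field_simp
    rw [e] at this
    linarith
  have e : ∑ r ∈ R, ((if vdc T (m * 4 ^ k + r) ∈ S then (1 : ℝ) else 0) - vol S / vol (triSet T)) =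
      hits.card - 4 ^ k * (vol S / vol (triSet T)) := by
    rw [Finset.sum_sub_distrib, Finset.sum_boole, Finset.sum_const, hR, Finset.card_range,
      nsmul_eq_mul]
    push_cast
    rfl
  have h1' : (inner.card : ℝ) ≤ hits.card := by exact_mod_cast h1
  have h2' : (hits.card : ℝ) ≤ meets.card := by exact_mod_cast h2
  have h3' : (meets.card : ℝ) ≤ inner.card + 2 * 2 ^ k := by exact_mod_cast h3
  rw [e, abs_le]
  constructor <;> linarith

lemma abs_sum_le_of_block_le {g : ℕ → ℝ}
    (hg : ∀ k m, |∑ r ∈ Finset.range (4 ^ k), g (m * 4 ^ k + r)| ≤ 2 * 2 ^ k) (M k : ℕ)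
    (hM : 1 ≤ M) :
    |∑ i ∈ Finset.range (M * 4 ^ k), g i| ≤ 2 * 2 ^ k * (6 * Real.sqrt M - 3) := by
  have hadd : ∀ Q t k, |∑ i ∈ Finset.range ((Q + t) * 4 ^ k), g i| ≤
      |∑ i ∈ Finset.range (Q * 4 ^ k), g i| + 2 * 2 ^ k * t := by
    intro Q t k
    induction t with
    | zero => simp
    | succ t ih =>
      rw [← add_assoc, add_one_mul, Finset.sum_range_add]
      refine (abs_add_le _ _).trans ((add_le_add ih (hg k (Q + t))).trans ?_)
      push_cast
      linarith
  induction M using Nat.strong_induction_on generalizing k with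
  | _ M ih =>
    have hr : ((M % 4 : ℕ) : ℝ) ≤ 3 := by
      exact_mod_cast Nat.lt_succ_iff.1 (Nat.mod_lt M (by norm_num))
    have h := hadd (4 * (M / 4)) (M % 4) k
    rw [Nat.div_add_mod] at h
    refine h.trans ?_
    have h2k : (0 : ℝ) < 2 ^ k := by positivity
    rcases Nat.eq_zero_or_pos (M / 4) with h0 | hpos
    · have hs : 1 ≤ Real.sqrt M := Real.one_le_sqrt.2 (by exact_mod_cast hM)
      simp only [h0, mul_zero, zero_mul, Finset.range_zero, Finset.sum_empty, abs_zero, zero_add]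
      gcongr
      linarith
    · have h' := ih (M / 4) (by omega) (k + 1) hpos
      rw [show 4 * (M / 4) * 4 ^ k = M / 4 * 4 ^ (k + 1) by ring]
      have hs : 2 * Real.sqrt (M / 4 : ℕ) ≤ Real.sqrt M := by
        refine Real.le_sqrt_of_sq_le ?_
        rw [mul_pow, Real.sq_sqrt (Nat.cast_nonneg _)]
        have : 4 * (M / 4) ≤ M := by omega
        norm_num
        exact_mod_cast this
      have e : 2 * 2 ^ (k + 1) * (6 * Real.sqrt (M / 4 : ℕ) - 3) + 2 * 2 ^ k * ((M % 4 : ℕ) : ℝ) =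
          2 * 2 ^ k * (6 * (2 * Real.sqrt (M / 4 : ℕ)) - 6 + ((M % 4 : ℕ) : ℝ)) := by ring
      refine (add_le_add h' le_rfl).trans (e.le.trans ?_)
      gcongr
      linarith

lemma abs_sdisc_cutSet_le {T : Tri2} {φ ψ : Pt →ᵃ[ℝ] ℝ} {c c' : ℕ} (h : GridVals φ c 1 T 0 false)
    (h' : GridVals ψ c' 1 T 0 false) (hc : c = 1 ∨ c = 2 ∨ c = 3) (hc' : c' = 1 ∨ c' = 2 ∨ c' = 3)
    (hne : c ≠ c') (a b : ℝ) (hT : 0 < vol (triSet T)) {N : ℕ} (hN : 1 ≤ N) :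
    |sdisc (cutSet T φ ψ a b) (fun i : Fin N => vdc T i) (triSet T)| ≤ 12 / Real.sqrt N := by
  classical
  have hsum := abs_sum_le_of_block_le
    (g := fun i => (if vdc T i ∈ cutSet T φ ψ a b then (1 : ℝ) else 0) -
      vol (cutSet T φ ψ a b) / vol (triSet T))
    (block_discrepancy_le h h' hc hc' hne a b hT) N 0 hN
  have hcap : cutSet T φ ψ a b ∩ triSet T = cutSet T φ ψ a b :=
    Set.inter_eq_left.2 fun x hx => hx.1
  rw [pow_zero, mul_one, Finset.sum_sub_distrib, Finset.sum_const, Finset.card_range,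
    nsmul_eq_mul] at hsum
  have hcard : (Nat.card {i : Fin N // vdc T i ∈ cutSet T φ ψ a b} : ℝ) =
      ∑ i ∈ Finset.range N, if vdc T i ∈ cutSet T φ ψ a b then (1 : ℝ) else 0 := by
    rw [Finset.sum_range (fun i => if vdc T i ∈ cutSet T φ ψ a b then (1 : ℝ) else 0),
      Finset.sum_boole, Nat.card_eq_fintype_card, Fintype.card_subtype]
  have hN0 : (0 : ℝ) < N := by exact_mod_cast hN
  have hs : 0 < Real.sqrt N := Real.sqrt_pos.2 hN0
  rw [sdisc, hcap, hcard, abs_sub_comm]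
  set X := ∑ i ∈ Finset.range N, if vdc T i ∈ cutSet T φ ψ a b then (1 : ℝ) else 0
  set v := vol (cutSet T φ ψ a b) / vol (triSet T)
  rw [show X / N - v = (X - N * v) / N by field_simp, abs_div, abs_of_pos hN0,
    div_le_div_iff₀ hN0 hs]
  have hNs : Real.sqrt N * Real.sqrt N = N := Real.mul_self_sqrt hN0.le
  have hX : |X - N * v| ≤ 12 * Real.sqrt N := by linarith
  calc |X - N * v| * Real.sqrt N ≤ 12 * Real.sqrt N * Real.sqrt N := by gcongr
    _ = 12 * N := by rw [mul_assoc, hNs]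

/-- The affine basis of the plane formed by the vertices of a nondegenerate triangle. -/
def Nondeg.basis {A B C : Pt} (h : Nondeg A B C) : AffineBasis (Fin 3) ℝ Pt where
  toFun := ![A, B, C]
  ind' := affineIndependent_iff_not_collinear_set.2 h
  tot' := by
    rw [(affineIndependent_iff_not_collinear_set.2 h).affineSpan_eq_top_iff_card_eq_finrank_add_one]
    simp

lemma triangle_eq_convexHull_range {A B C : Pt} :
    triangle A B C = convexHull ℝ (Set.range ![A, B, C]) := by
  rw [Matrix.range_cons, Matrix.range_cons_cons_empty, Set.singleton_union, triangle]

lemma vol_triangle_pos {A B C : Pt} (h : Nondeg A B C) : 0 < vol (triangle A B C) := by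
  refine ENNReal.toReal_pos (Measure.measure_pos_of_nonempty_interior _ ?_).ne'
    (Set.Finite.isCompact_convexHull ℝ (Set.toFinite _)).measure_ne_top
  have := h.basis.centroid_mem_interior_convexHull
  rw [triangle_eq_convexHull_range]
  exact ⟨_, this⟩

lemma affineMap_add_smul_sub (φ : Pt →ᵃ[ℝ] ℝ) (X Y Z : Pt) (s t : ℝ) :
    φ (Z + s • (X - Z) + t • (Y - Z)) = φ Z + s * (φ X - φ Z) + t * (φ Y - φ Z) := by
  rw [φ.decomp]
  simp only [Pi.add_apply, map_add, map_sub, map_smul, smul_eq_mul]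
  ring

lemma parlg_inter_triangle_eq {A B C : Pt} (h : Nondeg A B C) {i j l : Fin 3} (hij : i ≠ j)
    (hil : i ≠ l) (hjl : j ≠ l) (a b : ℝ) :
    parlg (h.basis i) (h.basis j) (h.basis l) a b ∩ triangle A B C =
      cutSet (A, B, C) (h.basis.coord i) (h.basis.coord j) a b := by
  have huniv : (Finset.univ : Finset (Fin 3)) = {i, j, l} := by decide +revert
  ext x
  constructor
  · rintro ⟨⟨s, t, -, hs, -, ht, rfl⟩, hT⟩
    refine ⟨hT, ?_, ?_⟩ <;> rw [affineMap_add_smul_sub]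
    · simpa [hij, hil]
    · simpa [hij.symm, hjl]
  · rintro ⟨hT, hx, hy⟩
    have hnn : ∀ m, 0 ≤ h.basis.coord m x := by
      have hT' : x ∈ triangle A B C := hT
      rw [triangle_eq_convexHull_range] at hT'
      exact (h.basis.convexHull_eq_nonneg_coord ▸ hT' :)
    refine ⟨⟨_, _, hnn i, hx, hnn j, hy, ?_⟩, hT⟩
    have hsum := h.basis.sum_coord_apply_eq_one x
    have hlin := h.basis.linear_combination_coord_eq_self x
    rw [huniv, Finset.sum_insert (by simp [hij, hil]), Finset.sum_insert (by simp [hjl]),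
      Finset.sum_singleton] at hsum hlin
    rw [show h.basis.coord l x = 1 - h.basis.coord i x - h.basis.coord j x by linarith] at hlin
    nth_rewrite 1 [← hlin]
    module

lemma gridVals_coord {A B C : Pt} (h : Nondeg A B C) (i : Fin 3) :
    GridVals (h.basis.coord i) (i + 1) 1 (A, B, C) 0 false := by
  have key : ∀ j : Fin 3, h.basis.coord i (h.basis j) = cornerBit (i + 1) (j + 1) false := by
    intro j
    rw [h.basis.coord_apply]
    fin_cases i <;> fin_cases j <;> simp [cornerBit]
  simp only [GridVals, Nat.cast_one, one_mul, Nat.cast_zero, zero_add]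
  exact ⟨key 0, key 1, key 2⟩

lemma abs_sdisc_anchored_le {A B C : Pt} (h : Nondeg A B C) {i j l : Fin 3} (hij : i ≠ j)
    (hil : i ≠ l) (hjl : j ≠ l) {N : ℕ} (hN : 1 ≤ N) (a b : ℝ) :
    |sdisc (parlg (h.basis i) (h.basis j) (h.basis l) a b ∩ triangle A B C)
      (fun n : Fin N => vdc (A, B, C) n) (triangle A B C)| ≤ 12 / Real.sqrt N := by
  rw [parlg_inter_triangle_eq h hij hil hjl]
  exact abs_sdisc_cutSet_le (gridVals_coord h i) (gridVals_coord h j) (by omega) (by omega)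
    (by omega) a b (vol_triangle_pos h) hN

/-- for any `N ≥ 1`, the first `N` triangular van der Corput points have
parallelogram discrepancy at most `12/√N`. -/
theorem parDisc_vdc_le (A B C : Pt) (h : Nondeg A B C) (N : ℕ) (hN : 1 ≤ N) :
    parDisc (fun i : Fin N => vdc (A, B, C) (i : ℕ)) A B C ≤ 12 / Real.sqrt N := by
  refine Real.iSup_le (fun S => Real.iSup_le (fun hS => ?_) (by positivity)) (by positivity)
  rcases hS with (⟨a, b, -, -, -, -, rfl⟩ | ⟨a, b, -, -, -, -, rfl⟩) | ⟨a, b, -, -, -, -, rfl⟩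
  · have hrot : triangle B C A = triangle A B C := by
      rw [triangle, triangle, Set.pair_comm C A, Set.insert_comm B A]
    rw [hrot]
    exact abs_sdisc_anchored_le h (i := 1) (j := 2) (l := 0) (by decide) (by decide) (by decide)
      hN a b
  · have hswap : triangle A C B = triangle A B C := by
      rw [triangle, triangle, Set.pair_comm C B]
    rw [hswap]
    exact abs_sdisc_anchored_le h (i := 0) (j := 2) (l := 1) (by decide) (by decide) (by decide)
      hN a b
  · exact abs_sdisc_anchored_le h (i := 0) (j := 1) (l := 2) (by decide) (by decide) (by decide)
      hN a b
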